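/- arXiv:1412.4569 — 2 statements merged into one kernel-verified Lean document; each statement's English description precedes it below -/
import Mathlib

section
/- Let n be a natural number, R > 0, and let a, b be positive real numbers with a ≠ b such that J_n(a·R) = 0 and J_n(b·R) = 0 (zero Dirichlet boundary condition). Then the eigenfunctions J_n(a·r) and J_n(b·r) are orthogonal on [0,R] with respect to the weight function r: ∫_0^R r · J_n(a·r) · J_n(b·r) dr = 0. -/
open MeasureTheory

/-- The Bessel function of the first kind of order `n`, defined by its power series. -/
noncomputable def besselJ (n : ℕ) (x : ℝ) : ℝ :=
  ∑' q : ℕ, (-1 : ℝ) ^ q / (Nat.factorial q * Nat.factorial (q + n)) * (x / 2) ^ (2 * q + n)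

/-- The entire function with `Jₙ(x) = (x/2)^n Eₙ(x²/4)`: its terms. -/
noncomputable def bTerm (n : ℕ) (y : ℝ) (q : ℕ) : ℝ :=
  (-1 : ℝ) ^ q / (Nat.factorial q * Nat.factorial (q + n)) * y ^ q

noncomputable def bE (n : ℕ) (y : ℝ) : ℝ := ∑' q : ℕ, bTerm n y q

noncomputable def bTerm' (n : ℕ) (y : ℝ) (q : ℕ) : ℝ :=
  (-1 : ℝ) ^ q / (Nat.factorial q * Nat.factorial (q + n)) * (q * y ^ (q - 1))

lemma bTerm_bound (n : ℕ) (y M : ℝ) (h : |y| ≤ M) (q : ℕ) :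
    ‖bTerm n y q‖ ≤ M ^ q / Nat.factorial q := by
  have h1 : (1 : ℝ) ≤ Nat.factorial (q + n) := by exact_mod_cast Nat.factorial_pos _
  have h2 : (0 : ℝ) < Nat.factorial q := by exact_mod_cast Nat.factorial_pos _
  have h3 : |y| ^ q ≤ M ^ q := by gcongr
  have hM : 0 ≤ M ^ q := le_trans (by positivity) h3
  rw [bTerm, Real.norm_eq_abs, abs_mul, abs_div, abs_pow, abs_pow, abs_neg, abs_one, one_pow,
    abs_of_pos (by positivity : (0 : ℝ) < Nat.factorial q * Nat.factorial (q + n)),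
    div_mul_eq_mul_div, one_mul]
  apply div_le_div₀ hM h3 h2
  nlinarith

lemma bTerm_summable (n : ℕ) (y : ℝ) : Summable (bTerm n y) :=
  Summable.of_norm_bounded (Real.summable_pow_div_factorial |y|)
    (bTerm_bound n y |y| le_rfl)

lemma bTerm'_succ (n : ℕ) (y : ℝ) (q : ℕ) : bTerm' n y (q + 1) = - bTerm (n + 1) y q := by
  have h2 : (Nat.factorial q : ℝ) ≠ 0 := by exact_mod_cast Nat.factorial_ne_zero _
  have h1 : (Nat.factorial (q + (n + 1)) : ℝ) ≠ 0 := by exact_mod_cast Nat.factorial_ne_zero _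
  have h3 : ((q : ℝ) + 1) ≠ 0 := by positivity
  rw [bTerm', bTerm, show q + 1 + n = q + (n + 1) by ring, Nat.factorial_succ q]
  push_cast
  field_simp
  ring

lemma bTerm'_hasSum (n : ℕ) (y : ℝ) : HasSum (bTerm' n y) (- bE (n + 1) y) := by
  have h : HasSum (fun q => bTerm' n y (q + 1)) (- bE (n + 1) y) := by
    simp only [bTerm'_succ]
    exact (bTerm_summable (n + 1) y).hasSum.neg
  have := (hasSum_nat_add_iff (f := bTerm' n y) 1).1 h
  simpa [bTerm'] using this

lemma bE_hasDerivAt (n : ℕ) (y : ℝ) : HasDerivAt (bE n) (- bE (n + 1) y) y := by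
  set M : ℝ := |y| + 1
  let u : ℕ → ℝ := fun q => if q = 0 then 0 else M ^ (q - 1) / Nat.factorial (q - 1)
  have hu : Summable u := by
    rw [← summable_nat_add_iff 1]
    simpa [u] using Real.summable_pow_div_factorial M
  have hy : y ∈ Metric.ball (0 : ℝ) M := by simp [M]
  have := hasDerivAt_tsum_of_isPreconnected (g := fun q z => bTerm n z q)
    (g' := fun q z => bTerm' n z q) hu Metric.isOpen_ball
    (convex_ball (0 : ℝ) M).isPreconnected
    (fun q z _ => by
      simp only [bTerm, bTerm']
      exact (hasDerivAt_pow q z).const_mul _)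
    (fun q z hz => by
      rcases q with _ | q
      · simp [bTerm', u]
      · rw [bTerm'_succ, norm_neg]
        simp only [u, Nat.add_sub_cancel, Nat.succ_ne_zero, if_false]
        apply bTerm_bound
        exact le_of_lt (by simpa using hz))
    hy (bTerm_summable n y) hy
  rw [(bTerm'_hasSum n y).tsum_eq] at this
  exact this

lemma bE_rec (n : ℕ) (y : ℝ) : bE n y = (n + 1) * bE (n + 1) y - y * bE (n + 2) y := by
  have h1 := ((bTerm_summable (n + 1) y).hasSum.mul_left ((n : ℝ) + 1)).add
    ((bTerm'_hasSum (n + 1) y).mul_left y)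
  have h2 : (fun q => ((n : ℝ) + 1) * bTerm (n + 1) y q + y * bTerm' (n + 1) y q)
      = bTerm n y := by
    funext q
    have h2 : (Nat.factorial q : ℝ) ≠ 0 := by exact_mod_cast Nat.factorial_ne_zero _
    have h1 : (Nat.factorial (q + n) : ℝ) ≠ 0 := by exact_mod_cast Nat.factorial_ne_zero _
    have h3 : ((q : ℝ) + n + 1) ≠ 0 := by positivity
    have h4 : y * ((q : ℝ) * y ^ (q - 1)) = q * y ^ q := by
      rcases q with _ | q
      · simp
      · simp only [Nat.add_sub_cancel]; ring
    have h5 : y * bTerm' (n + 1) y q = (-1 : ℝ) ^ q /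
        (Nat.factorial q * Nat.factorial (q + (n + 1))) * (q * y ^ q) := by
      rw [← h4, bTerm']; ring
    rw [h5, bTerm, bTerm, ← add_assoc, Nat.factorial_succ (q + n)]
    push_cast
    field_simp
    ring
  rw [h2] at h1
  have := h1.tsum_eq
  change bE n y = (n + 1) * bE (n + 1) y + y * (- bE (n + 1 + 1) y) at this
  rw [this]; ring

lemma besselJ_eq (n : ℕ) (x : ℝ) : besselJ n x = (x / 2) ^ n * bE n ((x / 2) ^ 2) := by
  rw [besselJ, bE, ← tsum_mul_left]
  congr 1
  funext q
  rw [bTerm, ← pow_mul]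
  ring

lemma besselJ_hasDerivAt (n : ℕ) (x : ℝ) :
    ∃ d, HasDerivAt (besselJ n) d x ∧ x * d = n * besselJ n x - x * besselJ (n + 1) x := by
  have h0 : HasDerivAt (fun x : ℝ => x / 2) (1 / 2) x := (hasDerivAt_id x).div_const 2
  have h1 := (bE_hasDerivAt n ((x / 2) ^ 2)).comp x (h0.pow 2)
  have h := (h0.pow n).mul h1
  refine ⟨_, h.congr_of_eventuallyEq (Filter.Eventually.of_forall fun z => besselJ_eq n z), ?_⟩
  rw [besselJ_eq, besselJ_eq]
  rcases n with _ | n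
  · simp; ring_nf; simp
  · simp; ring

lemma besselJ_rec (n : ℕ) (x : ℝ) :
    x * besselJ n x = 2 * (n + 1) * besselJ (n + 1) x - x * besselJ (n + 2) x := by
  rw [besselJ_eq, besselJ_eq, besselJ_eq, bE_rec n]
  ring

/-- Orthogonality of Bessel eigenfunctions under zero Dirichlet boundary conditions:
if `Jₙ(aR) = 0 = Jₙ(bR)` with `a ≠ b` positive, then
`∫_0^R r·Jₙ(ar)·Jₙ(br) dr = 0`. -/
theorem besselJ_orthogonality_dirichlet (n : ℕ) (R a b : ℝ) (hR : 0 < R)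
    (ha : 0 < a) (hb : 0 < b) (hab : a ≠ b)
    (haR : besselJ n (a * R) = 0) (hbR : besselJ n (b * R) = 0) :
    ∫ r in (0 : ℝ)..R, r * besselJ n (a * r) * besselJ n (b * r) = 0 := by
  have hc : Continuous (besselJ n) := continuous_iff_continuousAt.2 fun x =>
    (besselJ_hasDerivAt n x).choose_spec.1.continuousAt
  have key : ∀ r : ℝ, HasDerivAt (fun r => r * (a * besselJ (n + 1) (a * r) * besselJ n (b * r)
      - b * besselJ n (a * r) * besselJ (n + 1) (b * r)))
      ((a ^ 2 - b ^ 2) * (r * besselJ n (a * r) * besselJ n (b * r))) r := by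
    intro r
    have hl : ∀ c : ℝ, HasDerivAt (fun r : ℝ => c * r) c r := fun c => by
      simpa using (hasDerivAt_id r).const_mul c
    obtain ⟨da, hda, ea⟩ := besselJ_hasDerivAt n (a * r)
    obtain ⟨db, hdb, eb⟩ := besselJ_hasDerivAt n (b * r)
    obtain ⟨da1, hda1, ea1⟩ := besselJ_hasDerivAt (n + 1) (a * r)
    obtain ⟨db1, hdb1, eb1⟩ := besselJ_hasDerivAt (n + 1) (b * r)
    have ra := besselJ_rec n (a * r)
    have rb := besselJ_rec n (b * r)
    have ja := hda.comp r (hl a)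
    have jb := hdb.comp r (hl b)
    have ja1 := hda1.comp r (hl a)
    have jb1 := hdb1.comp r (hl b)
    have h := (hasDerivAt_id r).mul (((ja1.const_mul a).mul jb).sub ((ja.const_mul b).mul jb1))
    refine h.congr_deriv ?_
    simp only [Function.comp, id, Pi.mul_apply, Pi.sub_apply]
    push_cast at ea1 eb1
    rw [add_assoc n 1 1] at ea1 eb1
    norm_num at ea1 eb1
    linear_combination a * besselJ n (b * r) * (ea1 - ra) - b * besselJ n (a * r) * (eb1 - rb)
      + a * besselJ (n + 1) (a * r) * eb - b * besselJ (n + 1) (b * r) * ea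
  have hI := intervalIntegral.integral_eq_sub_of_hasDerivAt (a := 0) (b := R)
    (fun r _ => key r) (Continuous.intervalIntegrable (by fun_prop) _ _)
  rw [intervalIntegral.integral_const_mul, haR, hbR] at hI
  have hne : a ^ 2 - b ^ 2 ≠ 0 := by
    rw [sq_sub_sq]
    exact mul_ne_zero (by positivity) (sub_ne_zero.2 hab)
  simpa [hne] using hI
end

section
/- Let D, d : ℝ → ℝ be continuous (the immature diffusion and death rates), let k, s be real and τ ≥ 0. Define V(t,r,θ) := J_1(k·r)·cos(θ)·exp(−∫_0^{t−s} (k²·D(γ) + d(γ)) dγ). Then: (i) for all t, all θ, and all r > 0, V satisfies ∂V/∂t = D(t−s)·(∂²V/∂r² + (1/r)·∂V/∂r + (1/r²)·∂²V/∂θ²) − d(t−s)·V; (ii) V(s,r,θ) = J_1(k·r)·cos(θ); and (iii) V(s+τ,r,θ) = ε·e^{−k²·α}·J_1(k·r)·cos(θ), where ε := exp(−∫_0^τ d(a) da) and α := ∫_0^τ D(a) da. -/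
open MeasureTheory

/-- The entire function with `J_n(x) = (x/2)^n F_n(x²/4)`. -/
noncomputable def besselF (n : ℕ) (y : ℝ) : ℝ :=
  ∑' q : ℕ, (-1 : ℝ) ^ q / (Nat.factorial q * Nat.factorial (q + n)) * y ^ q

theorem besselCoef_bound (n q : ℕ) :
    |(-1 : ℝ) ^ q / (Nat.factorial q * Nat.factorial (q + n))| ≤ 1 / Nat.factorial q := by
  rw [abs_div, abs_pow, abs_neg, abs_one, one_pow, abs_of_nonneg (by positivity)]
  have h1 : (0 : ℝ) < Nat.factorial q := by exact_mod_cast Nat.factorial_pos q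
  have h2 : (1 : ℝ) ≤ Nat.factorial (q + n) := by exact_mod_cast Nat.factorial_pos (q + n)
  apply one_div_le_one_div_of_le h1
  nlinarith

theorem besselF_summable (n : ℕ) (y : ℝ) :
    Summable fun q : ℕ =>
      (-1 : ℝ) ^ q / (Nat.factorial q * Nat.factorial (q + n)) * y ^ q := by
  refine Summable.of_norm_bounded (Real.summable_pow_div_factorial |y|) fun q => ?_
  rw [Real.norm_eq_abs, abs_mul, abs_pow y, div_eq_mul_one_div (|y| ^ q), mul_comm]
  exact mul_le_mul_of_nonneg_left (besselCoef_bound n q) (by positivity)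

theorem besselF_hasDerivAt (n : ℕ) (y : ℝ) :
    HasDerivAt (besselF n) (-besselF (n + 1) y) y := by
  set R : ℝ := |y| + 1 with hR
  have hR0 : 0 ≤ R := by positivity
  have hu : Summable fun q : ℕ => (1 / (Nat.factorial q : ℝ)) * (q * R ^ (q - 1)) := by
    rw [← summable_nat_add_iff 1]
    refine (Real.summable_pow_div_factorial R).congr fun q => ?_
    have : (Nat.factorial q : ℝ) ≠ 0 := by positivity
    rw [Nat.factorial_succ]
    push_cast
    try simp only [Nat.add_sub_cancel]
    field_simp
  have hb : ∀ (q : ℕ) (z : ℝ), z ∈ Metric.ball (0 : ℝ) R →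
      ‖(-1 : ℝ) ^ q / (Nat.factorial q * Nat.factorial (q + n)) * (q * z ^ (q - 1))‖
        ≤ (1 / (Nat.factorial q : ℝ)) * (q * R ^ (q - 1)) := by
    intro q z hz
    have hz' : |z| ≤ R := by simpa using (Metric.mem_ball.1 hz).le
    rw [Real.norm_eq_abs, abs_mul, abs_mul, abs_pow z, Nat.abs_cast]
    have := besselCoef_bound n q
    gcongr
  have hy : y ∈ Metric.ball (0 : ℝ) R := by simp [hR]
  have key := hasDerivAt_tsum_of_isPreconnected hu Metric.isOpen_ball
    (convex_ball (0 : ℝ) R).isPreconnected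
    (g := fun (q : ℕ) (z : ℝ) =>
      (-1 : ℝ) ^ q / (Nat.factorial q * Nat.factorial (q + n)) * z ^ q)
    (fun q z _ => (hasDerivAt_pow q z).const_mul _) hb hy (besselF_summable n y) hy
  have e : (∑' q : ℕ, (-1 : ℝ) ^ q / (Nat.factorial q * Nat.factorial (q + n)) *
      (q * y ^ (q - 1))) = -besselF (n + 1) y := by
    rw [(Summable.of_norm_bounded hu fun q => hb q y hy).tsum_eq_zero_add, besselF, ← tsum_neg]
    simp only [Nat.cast_zero, zero_mul, mul_zero, zero_add]
    refine tsum_congr fun q => ?_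
    have h1 : (Nat.factorial q : ℝ) ≠ 0 := by positivity
    have h2 : (Nat.factorial (q + (n + 1)) : ℝ) ≠ 0 := by positivity
    rw [show q + 1 + n = q + (n + 1) by ring, Nat.factorial_succ q]
    push_cast
    try simp only [Nat.add_sub_cancel]
    field_simp
    ring
  rw [e] at key
  exact key

theorem besselF_rec (y : ℝ) : y * besselF 3 y - 2 * besselF 2 y + besselF 1 y = 0 := by
  have s1 := besselF_summable 1 y
  have s2 := besselF_summable 2 y
  have s3 := besselF_summable 3 y
  have hs : Summable fun q : ℕ => 2 * ((-1 : ℝ) ^ q / (Nat.factorial q * Nat.factorial (q + 2))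
      * y ^ q) - (-1 : ℝ) ^ q / (Nat.factorial q * Nat.factorial (q + 1)) * y ^ q :=
    (s2.mul_left 2).sub s1
  have h : 2 * besselF 2 y - besselF 1 y = y * besselF 3 y := by
    unfold besselF
    rw [← tsum_mul_left, ← tsum_mul_left, ← (s2.mul_left 2).tsum_sub s1, hs.tsum_eq_zero_add]
    norm_num [Nat.factorial]
    refine tsum_congr fun q => ?_
    have h1 : (Nat.factorial q : ℝ) ≠ 0 := by positivity
    field_simp
    ring
  linarith

theorem besselJ_one (x : ℝ) : besselJ 1 x = x / 2 * besselF 1 ((x / 2) ^ 2) := by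
  unfold besselJ besselF
  rw [← tsum_mul_left]
  refine tsum_congr fun q => ?_
  rw [pow_succ, pow_mul]
  ring

theorem besselF_comp_hasDerivAt (n : ℕ) (x : ℝ) :
    HasDerivAt (fun x => besselF n ((x / 2) ^ 2)) (-besselF (n + 1) ((x / 2) ^ 2) * (x / 2)) x := by
  have h : HasDerivAt (fun x : ℝ => (x / 2) ^ 2) (x / 2) x := by
    have := ((hasDerivAt_id x).div_const 2).pow 2
    refine HasDerivAt.congr_deriv this ?_
    simp only [id]
    norm_num
    try ring
  exact (besselF_hasDerivAt n ((x / 2) ^ 2)).comp x h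

/-- The first derivative of `J_1`. -/
noncomputable def besselA (x : ℝ) : ℝ :=
  1 / 2 * besselF 1 ((x / 2) ^ 2) - (x / 2) ^ 2 * besselF 2 ((x / 2) ^ 2)

/-- The second derivative of `J_1`. -/
noncomputable def besselB (x : ℝ) : ℝ :=
  -(3 / 4) * x * besselF 2 ((x / 2) ^ 2) + (x / 2) ^ 3 * besselF 3 ((x / 2) ^ 2)

theorem besselJ_one_hasDerivAt (x : ℝ) : HasDerivAt (besselJ 1) (besselA x) x := by
  rw [show besselJ 1 = _ from funext besselJ_one]
  have := ((hasDerivAt_id x).div_const 2).mul (besselF_comp_hasDerivAt 1 x)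
  refine HasDerivAt.congr_deriv this ?_
  simp only [besselA, id]
  ring

theorem besselA_hasDerivAt (x : ℝ) : HasDerivAt besselA (besselB x) x := by
  have h := ((hasDerivAt_id x).div_const 2).pow 2
  have := ((besselF_comp_hasDerivAt 1 x).const_mul (1 / 2)).sub
    (h.mul (besselF_comp_hasDerivAt 2 x))
  refine HasDerivAt.congr_deriv this ?_
  simp only [besselB, id, Pi.pow_apply]
  norm_num
  ring

theorem bessel_ode (x : ℝ) :
    x ^ 2 * besselB x + x * besselA x + (x ^ 2 - 1) * besselJ 1 x = 0 := by
  rw [besselJ_one, besselA, besselB]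
  linear_combination (x ^ 3 / 2) * besselF_rec ((x / 2) ^ 2)

/-- For `V(t,r,θ) := J₁(k·r)·cos θ·exp(−∫_0^{t−s} (k²·D(γ)+d(γ)) dγ)`:
(i) `V` solves the linear reaction–diffusion equation in polar coordinates for `r > 0`;
(ii) `V(s,r,θ) = J₁(k·r)·cos θ`;
(iii) `V(s+τ,r,θ) = ε·e^{−k²α}·J₁(k·r)·cos θ`, where `ε = exp(−∫_0^τ d)` and
`α = ∫_0^τ D`. -/
theorem single_mode_cohort_solution (D d : ℝ → ℝ) (hD : Continuous D)
    (hd : Continuous d) (k s τ : ℝ) (hτ : 0 ≤ τ) (V : ℝ → ℝ → ℝ → ℝ)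
    (hV : ∀ t r θ, V t r θ = besselJ 1 (k * r) * Real.cos θ *
      Real.exp (-∫ γ in (0 : ℝ)..(t - s), (k ^ 2 * D γ + d γ))) :
    (∀ (t θ r : ℝ), 0 < r →
      deriv (fun t' => V t' r θ) t =
        D (t - s) * (deriv (deriv (fun r' => V t r' θ)) r
          + (1 / r) * deriv (fun r' => V t r' θ) r
          + (1 / r ^ 2) * deriv (deriv (fun θ' => V t r θ')) θ)
        - d (t - s) * V t r θ) ∧
    (∀ r θ : ℝ, V s r θ = besselJ 1 (k * r) * Real.cos θ) ∧
    (∀ r θ : ℝ, V (s + τ) r θ =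
      Real.exp (-∫ a in (0 : ℝ)..τ, d a) * Real.exp (-k ^ 2 * ∫ a in (0 : ℝ)..τ, D a)
        * besselJ 1 (k * r) * Real.cos θ) := by
  have hint : ∀ a b, IntervalIntegrable (fun γ => k ^ 2 * D γ + d γ) volume a b := fun a b =>
    ((continuous_const.mul hD).add hd).intervalIntegrable a b
  refine ⟨fun t θ r hr => ?_, fun r θ => ?_, fun r θ => ?_⟩
  · simp only [hV]
    set E := fun t : ℝ => Real.exp (-∫ γ in (0 : ℝ)..(t - s), (k ^ 2 * D γ + d γ)) with hE
    have hEd : HasDerivAt E (E t * -(k ^ 2 * D (t - s) + d (t - s))) t := by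
      have hc : Continuous fun γ => k ^ 2 * D γ + d γ := (continuous_const.mul hD).add hd
      have h1 : HasDerivAt (fun u => ∫ γ in (0 : ℝ)..u, (k ^ 2 * D γ + d γ))
          (k ^ 2 * D (t - s) + d (t - s)) (t - s) :=
        hc.integral_hasStrictDerivAt 0 (t - s) |>.hasDerivAt
      have h2 := h1.comp_sub_const t s
      exact h2.neg.exp
    have hlin : ∀ x : ℝ, HasDerivAt (fun x => k * x) k x := fun x => by
      simpa using (hasDerivAt_id x).const_mul k
    have hJ : ∀ x, HasDerivAt (fun r' => besselJ 1 (k * r') * Real.cos θ * E t)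
        (besselA (k * x) * k * Real.cos θ * E t) x := fun x =>
      (((besselJ_one_hasDerivAt (k * x)).comp x (hlin x)).mul_const _).mul_const _
    have hA : HasDerivAt (fun x => besselA (k * x) * k * Real.cos θ * E t)
        (besselB (k * r) * k * k * Real.cos θ * E t) r :=
      ((((besselA_hasDerivAt (k * r)).comp r (hlin r)).mul_const _).mul_const _).mul_const _
    have hC : ∀ x, HasDerivAt (fun θ' => besselJ 1 (k * r) * Real.cos θ' * E t)
        (besselJ 1 (k * r) * -Real.sin x * E t) x := fun x =>
      ((Real.hasDerivAt_cos x).const_mul _).mul_const _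
    have hS : HasDerivAt (fun x => besselJ 1 (k * r) * -Real.sin x * E t)
        (besselJ 1 (k * r) * -Real.cos θ * E t) θ :=
      ((Real.hasDerivAt_sin θ).neg.const_mul _).mul_const _
    have hT := hEd.const_mul (besselJ 1 (k * r) * Real.cos θ)
    change deriv (fun t' => besselJ 1 (k * r) * Real.cos θ * E t') t =
      D (t - s) * (deriv (deriv (fun r' => besselJ 1 (k * r') * Real.cos θ * E t)) r
          + (1 / r) * deriv (fun r' => besselJ 1 (k * r') * Real.cos θ * E t) r
          + (1 / r ^ 2) * deriv (deriv (fun θ' => besselJ 1 (k * r) * Real.cos θ' * E t)) θ)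
        - d (t - s) * (besselJ 1 (k * r) * Real.cos θ * E t)
    rw [hT.deriv, (funext fun x => (hJ x).deriv :
        deriv (fun r' => besselJ 1 (k * r') * Real.cos θ * E t) = _),
      (funext fun x => (hC x).deriv :
        deriv (fun θ' => besselJ 1 (k * r) * Real.cos θ' * E t) = _), hA.deriv, hS.deriv]
    have ode := bessel_ode (k * r)
    field_simp
    linear_combination (-D (t - s) * Real.cos θ * E t) * ode
  · simp [hV]
  · rw [hV, add_sub_cancel_left, intervalIntegral.integral_add (f := fun x => k ^ 2 * D x)
      ((continuous_const.mul hD).intervalIntegrable _ _) (hd.intervalIntegrable _ _),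
      intervalIntegral.integral_const_mul, ← Real.exp_add, mul_comm, ← mul_assoc]
    congr 3
    ring
end
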